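/- arXiv:2405.04179 — 2 statements merged into one kernel-verified Lean document; each statement's English description precedes it below -/
import Mathlib

section
/- Let (X, M, *) be a fuzzy metric space, let T : X → Ĉ₀(X) be a (1)-Kannan contraction with constant c ∈ (0,1), let t₀ > 1, and let (x_n)_{n≥0} be a sequence in X such that x_{n+1} ∈ T x_n for all n ≥ 0 and M(x_n, x_{n+1}, t) ≥ Θ(T x_{n−1}, T x_n, t) for all n ≥ 1 and all t > 0. Then M(x_n, x_{n+1}, cⁿ t₀) > 1 − cⁿ t₀ for every n ≥ 1. -/
open Set Filter Topology

/-- A continuous t-norm: a binary operation on `[0,1]` (modeled as a real-valued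
operation whose behavior is specified on `Icc 0 1`) that is associative, commutative,
continuous, has `1` as unit, and is monotone in both arguments. -/
structure ContinuousTNorm where
  mul : ℝ → ℝ → ℝ
  mul_mem : ∀ a b : ℝ, a ∈ Icc (0:ℝ) 1 → b ∈ Icc (0:ℝ) 1 → mul a b ∈ Icc (0:ℝ) 1
  mul_assoc : ∀ a b c : ℝ, a ∈ Icc (0:ℝ) 1 → b ∈ Icc (0:ℝ) 1 → c ∈ Icc (0:ℝ) 1 →
    mul (mul a b) c = mul a (mul b c)
  mul_comm : ∀ a b : ℝ, a ∈ Icc (0:ℝ) 1 → b ∈ Icc (0:ℝ) 1 → mul a b = mul b a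
  continuousOn : ContinuousOn (fun p : ℝ × ℝ => mul p.1 p.2) (Icc (0:ℝ) 1 ×ˢ Icc (0:ℝ) 1)
  mul_one : ∀ a : ℝ, a ∈ Icc (0:ℝ) 1 → mul a 1 = a
  mul_mono : ∀ a b c d : ℝ, a ∈ Icc (0:ℝ) 1 → b ∈ Icc (0:ℝ) 1 → c ∈ Icc (0:ℝ) 1 →
    d ∈ Icc (0:ℝ) 1 → a ≤ c → b ≤ d → mul a b ≤ mul c d

/-- A fuzzy metric (in the sense of George–Veeramani) on `X` with respect to the
continuous t-norm `star`. -/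
structure FuzzyMetric (X : Type*) (star : ContinuousTNorm) where
  M : X → X → ℝ → ℝ
  pos : ∀ x y t, 0 < t → 0 < M x y t
  le_one : ∀ x y t, 0 < t → M x y t ≤ 1
  eq_iff : ∀ x y, (∀ t, 0 < t → M x y t = 1) ↔ x = y
  symm : ∀ x y t, 0 < t → M x y t = M y x t
  triangle : ∀ x y z t s, 0 < t → 0 < s →
    star.mul (M x y t) (M y z s) ≤ M x z (t + s)
  continuousOn : ∀ x y, ContinuousOn (M x y) (Ioi (0:ℝ))

/-- The fuzzy distance `𝓜(ρ, A, t) = sup { M(ρ, μ, t) : μ ∈ A }`. -/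
noncomputable def fuzzyDist {X : Type*} {star : ContinuousTNorm} (F : FuzzyMetric X star)
    (ρ : X) (A : Set X) (t : ℝ) : ℝ :=
  sSup ((fun μ => F.M ρ μ t) '' A)

/-- The Hausdorff fuzzy distance
`Θ(A, B, t) = min { inf_{ρ∈A} 𝓜(ρ, B, t), inf_{μ∈B} 𝓜(A, μ, t) }`. -/
noncomputable def hausdorffFuzzyDist {X : Type*} {star : ContinuousTNorm} (F : FuzzyMetric X star)
    (A B : Set X) (t : ℝ) : ℝ :=
  min (sInf ((fun ρ => fuzzyDist F ρ B t) '' A))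
      (sInf ((fun μ => fuzzyDist F μ A t) '' B))

/-- The topology on `X` generated by the open balls
`B(x, r, t) = { y | M(x, y, t) > 1 - r }` for `x ∈ X`, `r ∈ (0,1)`, `t > 0`. -/
def ballTopology {X : Type*} {star : ContinuousTNorm} (F : FuzzyMetric X star) :
    TopologicalSpace X :=
  TopologicalSpace.generateFrom
    { s : Set X | ∃ x : X, ∃ r t : ℝ, 0 < r ∧ r < 1 ∧ 0 < t ∧
        s = { y : X | 1 - r < F.M x y t } }

/-- `T : X → Set X` (with nonempty compact values) is a (1)-Kannan contraction
with constant `c ∈ (0,1)`. -/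
def IsKannanContraction {X : Type*} {star : ContinuousTNorm} (F : FuzzyMetric X star)
    (T : X → Set X) (c : ℝ) : Prop :=
  ∀ x y : X, ∀ t : ℝ, 0 < t →
    1 - t < min (fuzzyDist F x (T x) t) (fuzzyDist F y (T y) t) →
    1 - c * t < hausdorffFuzzyDist F (T x) (T y) (c * t)

/-- A sequence converges to `z` in the fuzzy metric sense. -/
def FuzzyConvergesTo {X : Type*} {star : ContinuousTNorm} (F : FuzzyMetric X star)
    (x : ℕ → X) (z : X) : Prop :=
  ∀ t : ℝ, 0 < t → Tendsto (fun n => F.M (x n) z t) atTop (𝓝 1)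

/-- A sequence is G-Cauchy. -/
def IsGCauchy {X : Type*} {star : ContinuousTNorm} (F : FuzzyMetric X star)
    (x : ℕ → X) : Prop :=
  ∀ t : ℝ, 0 < t → ∀ q : ℕ, Tendsto (fun n => F.M (x n) (x (n + q)) t) atTop (𝓝 1)

/-- Attainment property: for every `ρ`, nonempty compact `B`, and `t > 0`, the sup
defining `𝓜(ρ, B, t)` is attained at some `μ ∈ B`. -/
def AttainmentProperty {X : Type*} {star : ContinuousTNorm} (F : FuzzyMetric X star) : Prop :=
  ∀ (ρ : X) (B : Set X), B.Nonempty → (@IsCompact X (ballTopology F) B) →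
    ∀ t : ℝ, 0 < t → ∃ μ ∈ B, fuzzyDist F ρ B t = F.M ρ μ t

theorem FuzzyMetric.le_fuzzyDist {X : Type*} {star : ContinuousTNorm} (F : FuzzyMetric X star)
    (ρ : X) {A : Set X} {μ : X} (hμ : μ ∈ A) {t : ℝ} (ht : 0 < t) :
    F.M ρ μ t ≤ fuzzyDist F ρ A t :=
  le_csSup ⟨1, by rintro _ ⟨y, -, rfl⟩; exact F.le_one ρ y t ht⟩ ⟨μ, hμ, rfl⟩

/-- The estimate at scale `c ^ k * t₀` holds along the whole tail `n ≥ k` of the sequence. -/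
theorem IsKannanContraction.iterates_tail_estimate {X : Type*} {star : ContinuousTNorm}
    {F : FuzzyMetric X star} {T : X → Set X} {c : ℝ} (hc : 0 < c)
    (hK : IsKannanContraction F T c) {t₀ : ℝ} (ht₀ : 1 < t₀)
    {x : ℕ → X} (hx : ∀ n : ℕ, x (n + 1) ∈ T (x n))
    (hxM : ∀ n : ℕ, ∀ t : ℝ, 0 < t →
      hausdorffFuzzyDist F (T (x n)) (T (x (n + 1))) t ≤ F.M (x (n + 1)) (x (n + 2)) t)
    (k : ℕ) : ∀ n : ℕ, k ≤ n → 1 - c ^ k * t₀ < F.M (x n) (x (n + 1)) (c ^ k * t₀) := by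
  induction k with
  | zero =>
    intro n _
    have := F.pos (x n) (x (n + 1)) (c ^ 0 * t₀) (by positivity)
    rw [pow_zero, one_mul] at this ⊢
    linarith
  | succ k ih =>
    intro n hn
    obtain ⟨m, rfl⟩ : ∃ m, n = m + 1 := ⟨n - 1, by omega⟩
    have ht : 0 < c ^ k * t₀ := by positivity
    have h := hK (x m) (x (m + 1)) (c ^ k * t₀) ht
      (lt_min ((ih m (by omega)).trans_le (F.le_fuzzyDist _ (hx m) ht))
        ((ih (m + 1) (by omega)).trans_le (F.le_fuzzyDist _ (hx (m + 1)) ht)))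
    rw [← mul_assoc, ← pow_succ'] at h
    exact h.trans_le (hxM m _ (by positivity))

/-- For a (1)-Kannan contraction `T` with constant `c ∈ (0,1)`, `t₀ > 1`, and a
sequence with `x_{n+1} ∈ T x_n` and `M(x_n, x_{n+1}, t) ≥ Θ(T x_{n-1}, T x_n, t)`
for `n ≥ 1`, we have `M(x_n, x_{n+1}, cⁿ t₀) > 1 - cⁿ t₀` for every `n ≥ 1`. -/
theorem kannan_iterates_estimate {X : Type*} {star : ContinuousTNorm}
    (F : FuzzyMetric X star) (T : X → Set X)
    (hTne : ∀ x : X, (T x).Nonempty)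
    (hTcpt : ∀ x : X, @IsCompact X (ballTopology F) (T x))
    (c : ℝ) (hc : c ∈ Set.Ioo (0 : ℝ) 1) (hK : IsKannanContraction F T c)
    (t₀ : ℝ) (ht₀ : 1 < t₀)
    (x : ℕ → X) (hx : ∀ n : ℕ, x (n + 1) ∈ T (x n))
    (hxM : ∀ n : ℕ, ∀ t : ℝ, 0 < t →
      hausdorffFuzzyDist F (T (x n)) (T (x (n + 1))) t ≤ F.M (x (n + 1)) (x (n + 2)) t) :
    ∀ n : ℕ, 1 ≤ n → 1 - c ^ n * t₀ < F.M (x n) (x (n + 1)) (c ^ n * t₀) :=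
  fun n _ => hK.iterates_tail_estimate hc.1 ht₀ hx hxM n n le_rfl
end

section
/- Let (X, M, *) be a fuzzy metric space, let c ∈ (0,1) and t₀ > 0, and let (x_n) be a sequence in X such that M(x_n, x_{n+1}, cⁿ t₀) > 1 − cⁿ t₀ for every n ∈ ℕ. Then (x_n) is a G-Cauchy sequence, i.e., lim_{n→∞} M(x_n, x_{n+q}, t) = 1 for every t > 0 and every q ∈ ℕ. -/
open Set Filter Topology

namespace FuzzyMetric

variable {X : Type*} {star : ContinuousTNorm} (F : FuzzyMetric X star)

theorem mem_Icc (x y : X) {t : ℝ} (ht : 0 < t) : F.M x y t ∈ Icc (0 : ℝ) 1 :=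
  ⟨(F.pos x y t ht).le, F.le_one x y t ht⟩

theorem self_eq_one (x : X) {t : ℝ} (ht : 0 < t) : F.M x x t = 1 :=
  (F.eq_iff x x).2 rfl t ht

theorem mono_right (x y : X) {s t : ℝ} (hs : 0 < s) (hst : s ≤ t) : F.M x y s ≤ F.M x y t := by
  obtain rfl | hlt := hst.eq_or_lt
  · exact le_rfl
  · have h := F.triangle x y y s (t - s) hs (sub_pos.2 hlt)
    rwa [F.self_eq_one y (sub_pos.2 hlt), star.mul_one _ (F.mem_Icc x y hs),
      add_sub_cancel] at h

theorem tendsto_one_trans {ι : Type*} {l : Filter ι} {x y z : ι → X} {t : ℝ} (ht : 0 < t)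
    (hxy : ∀ s : ℝ, 0 < s → Tendsto (fun i => F.M (x i) (y i) s) l (𝓝 1))
    (hyz : ∀ s : ℝ, 0 < s → Tendsto (fun i => F.M (y i) (z i) s) l (𝓝 1)) :
    Tendsto (fun i => F.M (x i) (z i) t) l (𝓝 1) := by
  have h2 : 0 < t / 2 := half_pos ht
  have hone : (1 : ℝ) ∈ Icc (0 : ℝ) 1 := right_mem_Icc.2 zero_le_one
  have hpair : Tendsto (fun i => (F.M (x i) (y i) (t / 2), F.M (y i) (z i) (t / 2))) l
      (𝓝[Icc (0 : ℝ) 1 ×ˢ Icc (0 : ℝ) 1] (1, 1)) :=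
    tendsto_nhdsWithin_iff.2 ⟨(hxy _ h2).prodMk_nhds (hyz _ h2),
      Eventually.of_forall fun i => ⟨F.mem_Icc _ _ h2, F.mem_Icc _ _ h2⟩⟩
  have hmul := (star.continuousOn (1, 1) ⟨hone, hone⟩).tendsto.comp hpair
  simp only [star.mul_one 1 hone] at hmul
  refine tendsto_of_tendsto_of_tendsto_of_le_of_le hmul tendsto_const_nhds (fun i => ?_)
    fun i => F.le_one _ _ _ ht
  simpa using F.triangle (x i) (y i) (z i) (t / 2) (t / 2) h2 h2

end FuzzyMetric

/-- If `c ∈ (0,1)`, `t₀ > 0`, and `M(x_n, x_{n+1}, cⁿ t₀) > 1 - cⁿ t₀` for all `n`,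
then `(x_n)` is a G-Cauchy sequence. -/
theorem isGCauchy_of_estimate {X : Type*} {star : ContinuousTNorm}
    (F : FuzzyMetric X star) (c : ℝ) (hc : c ∈ Set.Ioo (0 : ℝ) 1)
    (t₀ : ℝ) (ht₀ : 0 < t₀) (x : ℕ → X)
    (hx : ∀ n : ℕ, 1 - c ^ n * t₀ < F.M (x n) (x (n + 1)) (c ^ n * t₀)) :
    IsGCauchy F x := by
  have hzero : Tendsto (fun n : ℕ => c ^ n * t₀) atTop (𝓝 0) := by
    simpa using (tendsto_pow_atTop_nhds_zero_of_lt_one hc.1.le hc.2).mul_const t₀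
  have hstep : ∀ t : ℝ, 0 < t → Tendsto (fun n => F.M (x n) (x (n + 1)) t) atTop (𝓝 1) := by
    intro t ht
    have hlow : Tendsto (fun n : ℕ => 1 - c ^ n * t₀) atTop (𝓝 1) := by
      simpa using hzero.const_sub 1
    refine tendsto_of_tendsto_of_tendsto_of_le_of_le' hlow tendsto_const_nhds ?_
      (Eventually.of_forall fun n => F.le_one _ _ _ ht)
    filter_upwards [hzero.eventually_le_const ht] with n hn
    exact (hx n).le.trans (F.mono_right _ _ (mul_pos (pow_pos hc.1 n) ht₀) hn)
  intro t ht q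
  induction q generalizing t with
  | zero => simp [F.self_eq_one _ ht]
  | succ q ih =>
    exact F.tendsto_one_trans ht ih fun s hs => (hstep s hs).comp (tendsto_add_atTop_nat q)
end
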